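/- (Fountain theorem under the Cerami condition.) Let X be a real Banach space and (e_j)_{j≥1} a sequence in X whose closed linear span is all of X. For k ≥ 1 set Y_k = span{e_1, …, e_k} and Z_k = the closed linear span of {e_j : j ≥ k}. Let J : X → ℝ be a C¹ functional (Fréchet differentiable with continuous derivative) that is even, i.e. J(−u) = J(u) for all u ∈ X, and suppose J satisfies the Cerami condition at every level c ∈ ℝ, namely: (i) every bounded sequence (u_n) in X with J(u_n) → c and ‖dJ(u_n)‖_{X*} → 0 has a convergent subsequence; and (ii) there exist δ, r, β > 0 such that ‖dJ(u)‖_{X*}·‖u‖ ≥ β for every u with c − δ ≤ J(u) ≤ c + δ and ‖u‖ ≥ r. Assume that for every k ∈ ℕ there exist ρ_k > r_k > 0 such that (A₁) a_k := inf{J(u) : u ∈ Z_k, ‖u‖ = r_k} → ∞ as k → ∞, and (A₂) b_k := sup{J(u) : u ∈ Y_k, ‖u‖ = ρ_k} ≤ 0. Then J has an unbounded sequence of critical values: there exists a sequence (u_n) in X with dJ(u_n) = 0 and J(u_n) → ∞ as n → ∞. -/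

import Mathlib

open Filter Topology

namespace Fountain

/-! ### Part 1: Ky Fan type parity lemma for label lists -/

/-- Indicator that a list of labels (all `≥ 2`) has alternating parities starting with `b`. -/
def alt : Bool → List ℕ → ZMod 2
  | _, [] => 1
  | b, a :: t => if 2 ≤ a ∧ (a % 2 == 1) = b then alt (!b) t else 0

/-- Indicator of the pattern: the label `0` followed by an alternating list. -/
def pat (b : Bool) : List ℕ → ZMod 2
  | [] => 0
  | a :: t => if a = 0 then alt b t else 0

/-- Sum over all removals of one entry. -/
def rmv : (List ℕ → ZMod 2) → List ℕ → ZMod 2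
  | _, [] => 0
  | F, a :: t => F t + rmv (fun t' => F (a :: t')) t

lemma z2 (x : ZMod 2) : x + x = 0 := CharTwo.add_self_eq_zero x

lemma rmv_zero (l : List ℕ) : rmv (fun _ => 0) l = 0 := by
  induction l with
  | nil => rfl
  | cons a t ih => simp [rmv, ih]

lemma rmv_alt (l : List ℕ) (h : ∀ a ∈ l, 2 ≤ a) (b : Bool) :
    rmv (alt b) l = alt b l + alt (!b) l := by
  induction l generalizing b with
  | nil => simp [rmv, alt, z2]
  | cons a t ih =>
    have ha : 2 ≤ a := h a (by simp)
    have ih' := ih (fun c hc => h c (by simp [hc]))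
    by_cases hb : (a % 2 == 1) = b
    · have hb2 : ¬ ((a % 2 == 1) = !b) := by rw [hb]; cases b <;> simp
      have : (fun t' => alt b (a :: t')) = alt (!b) := by
        funext t'; simp only [alt]; rw [if_pos ⟨ha, hb⟩]
      simp only [rmv, this]
      rw [ih' (!b)]
      simp only [alt]
      rw [if_pos ⟨ha, hb⟩, if_neg (fun h => hb2 h.2)]
      rw [Bool.not_not, add_comm (alt (!b) t), ← add_assoc, z2]; simp
    · have hb2 : ((a % 2 == 1) = !b) := by
        revert hb; cases (a % 2 == 1) <;> cases b <;> simp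
      have : (fun t' => alt b (a :: t')) = fun _ => 0 := by
        funext t'; simp only [alt]; rw [if_neg (fun h => hb h.2)]
      simp only [rmv, this, rmv_zero]
      simp only [alt]
      rw [if_neg (fun h => hb h.2), if_pos ⟨ha, hb2⟩]
      simp

lemma rmv_pat (l : List ℕ) (hs : l.Pairwise (· ≤ ·)) (h : 0 ∈ l → 1 ∉ l) (b : Bool) :
    rmv (pat b) l = pat b l + pat (!b) l := by
  cases l with
  | nil => simp [rmv, pat]
  | cons a t =>
    by_cases ha : a = 0
    · subst ha
      have : (fun t' => pat b (0 :: t')) = alt b := by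
        funext t'; simp [pat]
      simp only [rmv, this]
      cases t with
      | nil => simp [pat, rmv, alt, z2]
      | cons c t' =>
        by_cases hc : c = 0
        · subst hc
          have : (fun t' => alt b (0 :: t')) = fun _ => 0 := by
            funext t'; simp [alt]
          simp [pat, rmv, rmv_zero, alt, z2]
        · rw [rmv_alt]
          · simp [pat, hc]
          · intro d hd
            have h1 : d ≠ 1 := by
              rintro rfl
              exact h (by simp) (by simp [hd])
            have h2 : c ≤ d := by
              rw [List.pairwise_cons] at hs
              have hs2 := hs.2
              rw [List.pairwise_cons] at hs2
              rcases List.mem_cons.1 hd with rfl | hd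
              · exact le_rfl
              · exact hs2.1 d hd
            omega
    · have : (fun t' => pat b (a :: t')) = fun _ => 0 := by
        funext t'; simp [pat, ha]
      simp only [rmv, this, rmv_zero]
      cases t with
      | nil => simp [pat, ha]
      | cons c t' =>
        have : a ≤ c := by
          rw [List.pairwise_cons] at hs
          exact hs.1 c (by simp)
        have hc : c ≠ 0 := by omega
        simp [pat, ha, hc]

lemma sum_erase (l : List ℕ) (hs : l.Pairwise (· ≤ ·)) (F : List ℕ → ZMod 2) :
    (l.map (fun a => F (l.erase a))).sum = rmv F l := by
  induction l generalizing F with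
  | nil => simp [rmv]
  | cons a t ih =>
    rw [List.pairwise_cons] at hs
    simp only [List.map_cons, List.sum_cons, List.erase_cons_head, rmv]
    rw [← ih hs.2]
    congr 2
    apply List.map_congr_left
    intro c hc
    by_cases hca : c = a
    · subst hca
      cases t with
      | nil => simp at hc
      | cons d t' =>
        have h1 := hs.1 d (by simp)
        have h2 : d ≤ c := by
          rcases List.mem_cons.1 hc with rfl | hd
          · exact le_rfl
          · exact (List.pairwise_cons.1 hs.2).1 c hd
        have : d = c := le_antisymm h2 h1
        subst this
        simp
    · rw [List.erase_cons_tail]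
      simpa using fun h => hca h.symm

/-- Pattern indicator on multisets of labels. -/
def mpat (b : Bool) (M : Multiset ℕ) : ZMod 2 := pat b (M.sort (· ≤ ·))

lemma sort_unique (l : List ℕ) (hs : l.Pairwise (· ≤ ·)) :
    (l : Multiset ℕ).sort (· ≤ ·) = l := by
  rw [Multiset.coe_sort]; exact List.mergeSort_eq_self _ hs

lemma mpat_erase (M : Multiset ℕ) (h : 0 ∈ M → 1 ∉ M) (b : Bool) :
    (M.map (fun a => mpat b (M.erase a))).sum = mpat b M + mpat (!b) M := by
  obtain ⟨l, hs, rfl⟩ : ∃ l : List ℕ, l.Pairwise (· ≤ ·) ∧ M = (l : Multiset ℕ) :=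
    ⟨M.sort (· ≤ ·), Multiset.pairwise_sort _ _, (Multiset.sort_eq _ _).symm⟩
  unfold mpat
  rw [sort_unique l hs, ← rmv_pat l hs (by simpa using h), ← sum_erase l hs]
  rw [Multiset.map_coe, Multiset.sum_coe]
  congr 1
  apply List.map_congr_left
  intro a _
  rw [Multiset.coe_erase, sort_unique]
  exact hs.sublist List.erase_sublist

/-- Negation of labels. -/
def neg (a : ℕ) : ℕ := if a < 2 then a else if a % 2 = 0 then a + 1 else a - 1

lemma alt_neg (b : Bool) (l : List ℕ) : alt b (l.map neg) = alt (!b) l := by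
  induction l generalizing b with
  | nil => rfl
  | cons a t ih =>
    simp only [List.map_cons, alt, ih]
    have : (2 ≤ neg a ∧ (neg a % 2 == 1) = b) ↔ (2 ≤ a ∧ (a % 2 == 1) = !b) := by
      have h3 : (neg a % 2 = 1 ↔ (2 ≤ a ∧ a % 2 = 0) ∨ a = 1) ∧ (2 ≤ neg a ↔ 2 ≤ a) := by
        unfold neg
        by_cases h2 : a < 2
        · rw [if_pos h2]; omega
        · rw [if_neg h2]
          by_cases h0 : a % 2 = 0
          · rw [if_pos h0]; omega
          · rw [if_neg h0]; omega
      cases b <;> simp only [h3.2, beq_eq_false_iff_ne, ne_eq, h3.1, beq_iff_eq,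
        Bool.not_false, Bool.not_true] <;> grind
    simp only [this]

lemma pat_neg (b : Bool) (l : List ℕ) : pat b (l.map neg) = pat (!b) l := by
  cases l with
  | nil => rfl
  | cons a t =>
    simp only [List.map_cons, pat, alt_neg]
    have : neg a = 0 ↔ a = 0 := by
      unfold neg
      grind
    simp only [this]

lemma mpat_neg (b : Bool) (M : Multiset ℕ)
    (h : ∀ a ∈ M, ∀ c ∈ M, a / 2 = c / 2 → a = c) :
    mpat b (M.map neg) = mpat (!b) M := by
  obtain ⟨l, hs, rfl⟩ : ∃ l : List ℕ, l.Pairwise (· ≤ ·) ∧ M = (l : Multiset ℕ) :=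
    ⟨M.sort (· ≤ ·), Multiset.pairwise_sort _ _, (Multiset.sort_eq _ _).symm⟩
  unfold mpat
  rw [Multiset.map_coe, sort_unique l hs, sort_unique, pat_neg]
  rw [List.pairwise_map]
  refine hs.imp_of_mem ?_
  intro a c ha hc hac
  have := h a (by simpa using ha) c (by simpa using hc)
  unfold neg
  split_ifs <;> omega

lemma alt_bound (d : ℕ) (b : Bool) (l : List ℕ) (a : ℕ) (hs : (a :: l).Pairwise (· ≤ ·))
    (hpar : (a % 2 == 1) = !b)
    (h : ∀ x ∈ a :: l, ∀ c ∈ a :: l, x / 2 = c / 2 → x = c) (hd : ∀ x ∈ a :: l, x / 2 ≤ d)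
    (h1 : alt b l ≠ 0) : a / 2 + l.length ≤ d := by
  induction l generalizing a b with
  | nil => simpa using hd a (by simp)
  | cons c t ih =>
    simp only [alt] at h1
    split_ifs at h1 with hc
    · have := ih (!b) c (List.pairwise_cons.1 hs).2 (by simpa using hc.2)
        (fun x hx y hy => h x (List.mem_cons_of_mem _ hx) y (List.mem_cons_of_mem _ hy))
        (fun x hx => hd x (List.mem_cons_of_mem _ hx)) h1
      have hac := (List.pairwise_cons.1 hs).1 c (by simp)
      have hne : a ≠ c := by
        rintro rfl
        rw [hc.2] at hpar
        cases b <;> simp at hpar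
      have := h a (by simp) c (by simp)
      simp only [List.length_cons]
      omega
    · exact absurd rfl h1

lemma mpat_bound (d : ℕ) (b : Bool) (M : Multiset ℕ)
    (h : ∀ a ∈ M, ∀ c ∈ M, a / 2 = c / 2 → a = c) (hd : ∀ a ∈ M, a / 2 ≤ d)
    (h1 : mpat b M ≠ 0) : M.card ≤ d + 1 := by
  obtain ⟨l, hs, rfl⟩ : ∃ l : List ℕ, l.Pairwise (· ≤ ·) ∧ M = (l : Multiset ℕ) :=
    ⟨M.sort (· ≤ ·), Multiset.pairwise_sort _ _, (Multiset.sort_eq _ _).symm⟩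
  unfold mpat at h1
  rw [sort_unique l hs] at h1
  simp only [Multiset.mem_coe, Multiset.coe_card] at *
  cases l with
  | nil => simp
  | cons a t =>
    simp only [pat] at h1
    split_ifs at h1 with ha
    · subst ha
      cases t with
      | nil => simp
      | cons c t =>
        simp only [alt] at h1
        split_ifs at h1 with hc
        · have := alt_bound d (!b) t c (List.pairwise_cons.1 hs).2 (by simpa using hc.2)
            (fun x hx y hy => h x (List.mem_cons_of_mem _ hx) y (List.mem_cons_of_mem _ hy))
            (fun x hx => hd x (List.mem_cons_of_mem _ hx)) h1
          simp only [List.length_cons]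
          omega
        · exact absurd rfl h1
    · exact absurd rfl h1

/-! ### Part 2: the Kuhn triangulation of a cube -/

lemma mpat_ne (b : Bool) (M : Multiset ℕ) (h : mpat b M ≠ 0) : 0 ∈ M := by
  unfold mpat at h
  have hM : (M.sort (· ≤ ·) : Multiset ℕ) = M := Multiset.sort_eq _ _
  rw [← hM]
  cases hl : M.sort (· ≤ ·) with
  | nil => rw [hl] at h; exact absurd rfl h
  | cons a t =>
    rw [hl] at h
    simp only [pat] at h
    split_ifs at h with ha
    · simp [ha]
    · exact absurd rfl h

/-- The `t`-th vertex of the Kuhn simplex based at `x` with ordering `τ`. -/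
def vert {n : ℕ} (x : Fin n → ℤ) (τ : Equiv.Perm (Fin n)) (t : ℕ) : Fin n → ℤ :=
  fun m => x m + if (τ m : ℕ) < t then 1 else 0

/-- Labels of a simplex. -/
def room {n : ℕ} (l : (Fin n → ℤ) → ℕ) (p : (Fin n → ℤ) × Equiv.Perm (Fin n)) : Multiset ℕ :=
  (Finset.range (n + 1)).val.map (fun t => l (vert p.1 p.2 t))

/-- Labels of a facet. -/
def facet {n : ℕ} (l : (Fin n → ℤ) → ℕ) (p : (Fin n → ℤ) × Equiv.Perm (Fin n)) (i : ℕ) :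
    Multiset ℕ :=
  ((Finset.range (n + 1)).erase i).val.map (fun t => l (vert p.1 p.2 t))

/-- The conditions on a labelling. -/
structure Good (n : ℕ) (N : ℤ) (l : (Fin n → ℤ) → ℕ) : Prop where
  nc : ∀ u v : Fin n → ℤ, (∀ m, |u m| ≤ N) → (∀ m, |v m| ≤ N) → (∀ m, |u m - v m| ≤ 1) →
    l u / 2 = l v / 2 → l u = l v
  odd : ∀ u : Fin n → ℤ, (∀ m, |u m| ≤ N) → l (-u) = neg (l u)
  bd : ∀ u : Fin n → ℤ, (∀ m, |u m| ≤ N) → ∀ m, |u m| = N → l u ≠ 0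

/-- Base points of the cubes of the grid. -/
noncomputable def box (n : ℕ) (N : ℤ) : Finset (Fin n → ℤ) := Fintype.piFinset (fun _ => Finset.Ico (-N) N)

lemma mem_box {n : ℕ} {N : ℤ} {x : Fin n → ℤ} : x ∈ box n N ↔ ∀ m, -N ≤ x m ∧ x m < N := by
  simp [box]

/-- All simplices. -/
noncomputable def simplexSet (n : ℕ) (N : ℤ) : Finset ((Fin n → ℤ) × Equiv.Perm (Fin n)) :=
  box n N ×ˢ Finset.univ

lemma mem_simplexSet {n : ℕ} {N : ℤ} {p : (Fin n → ℤ) × Equiv.Perm (Fin n)} :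
    p ∈ simplexSet n N ↔ ∀ m, -N ≤ p.1 m ∧ p.1 m < N := by
  simp [simplexSet, mem_box]

/-- Number (mod 2) of simplices with the pattern. -/
noncomputable def cnt (n : ℕ) (N : ℤ) (l : (Fin n → ℤ) → ℕ) (b : Bool) : ZMod 2 :=
  ∑ p ∈ simplexSet n N, mpat b (room l p)

lemma vert_mem {n : ℕ} {N : ℤ} {p : (Fin n → ℤ) × Equiv.Perm (Fin n)} (hp : p ∈ simplexSet n N)
    (t : ℕ) (m : Fin n) : |vert p.1 p.2 t m| ≤ N := by
  have := mem_simplexSet.1 hp m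
  unfold vert
  rw [abs_le]
  split_ifs <;> omega

lemma vert_adj {n : ℕ} (p : (Fin n → ℤ) × Equiv.Perm (Fin n))
    (s t : ℕ) (m : Fin n) : |vert p.1 p.2 s m - vert p.1 p.2 t m| ≤ 1 := by
  unfold vert
  rw [abs_le]
  split_ifs <;> omega

lemma room_nc {n : ℕ} {N : ℤ} {l : (Fin n → ℤ) → ℕ} (hl : Good n N l)
    {p : (Fin n → ℤ) × Equiv.Perm (Fin n)} (hp : p ∈ simplexSet n N) :
    ∀ a ∈ room l p, ∀ c ∈ room l p, a / 2 = c / 2 → a = c := by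
  intro a ha c hc
  unfold room at ha hc
  rw [Multiset.mem_map] at ha hc
  obtain ⟨s, -, rfl⟩ := ha
  obtain ⟨t, -, rfl⟩ := hc
  exact hl.nc _ _ (vert_mem hp s) (vert_mem hp t) (vert_adj p s t)

lemma sum_facet {n : ℕ} {N : ℤ} {l : (Fin n → ℤ) → ℕ} (hl : Good n N l) (b : Bool)
    {p : (Fin n → ℤ) × Equiv.Perm (Fin n)} (hp : p ∈ simplexSet n N) :
    ∑ i ∈ Finset.range (n + 1), mpat b (facet l p i)
      = mpat b (room l p) + mpat (!b) (room l p) := by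
  rw [← mpat_erase]
  · have : ∀ i ∈ Finset.range (n + 1), mpat b (facet l p i)
        = mpat b ((room l p).erase (l (vert p.1 p.2 i))) := by
      intro i hi
      unfold facet room
      rw [Finset.erase_val, Multiset.map_erase_of_mem _ _ hi]
    rw [Finset.sum_congr rfl this]
    unfold room
    rw [Multiset.map_map]
    rfl
  · intro h0 h1
    have := room_nc hl hp 0 h0 1 h1 (by norm_num)
    omega

lemma map_val_image {s t : Finset ℕ} (f : ℕ → ℕ) (hf : Set.InjOn f s) (h : s.image f = t)
    (g : ℕ → ℕ) : t.val.map g = s.val.map (fun i => g (f i)) := by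
  rw [← h, Finset.image_val_of_injOn hf, Multiset.map_map]
  rfl

/-- Reflection of a simplex. -/
def reflSimplex {n : ℕ} (p : (Fin n → ℤ) × Equiv.Perm (Fin n)) : (Fin n → ℤ) × Equiv.Perm (Fin n) :=
  (fun m => - p.1 m - 1, p.2.trans Fin.revPerm)

lemma vert_refl {n : ℕ} (p : (Fin n → ℤ) × Equiv.Perm (Fin n)) (t : ℕ) (ht : t ≤ n) :
    vert (reflSimplex p).1 (reflSimplex p).2 (n - t) = - vert p.1 p.2 t := by
  funext m
  have := (p.2 m).2
  simp only [reflSimplex, vert, Equiv.trans_apply, Fin.revPerm_apply, Fin.val_rev, Pi.neg_apply]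
  split_ifs <;> omega

lemma refl_refl {n : ℕ} (p : (Fin n → ℤ) × Equiv.Perm (Fin n)) : reflSimplex (reflSimplex p) = p := by
  unfold reflSimplex
  ext m
  · simp
  · simp

lemma room_refl {n : ℕ} {N : ℤ} {l : (Fin n → ℤ) → ℕ} (hl : Good n N l)
    {p : (Fin n → ℤ) × Equiv.Perm (Fin n)} (hp : p ∈ simplexSet n N) :
    room l (reflSimplex p) = (room l p).map neg := by
  unfold room
  rw [Multiset.map_map, map_val_image (s := Finset.range (n + 1)) (fun t => n - t)]
  · apply Multiset.map_congr rfl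
    intro t ht
    have ht : t < n + 1 := Finset.mem_range.1 ht
    rw [vert_refl _ _ (by omega), hl.odd _ (vert_mem hp t)]
    rfl
  · intro a ha c hc h
    simp only [Finset.coe_range, Set.mem_Iio] at ha hc h
    omega
  · ext a
    simp only [Finset.mem_image, Finset.mem_range]
    constructor
    · rintro ⟨c, hc, rfl⟩; omega
    · intro ha; exact ⟨n - a, by omega, by omega⟩

/-- Simplices in the lower half. -/
noncomputable def half (n : ℕ) (N : ℤ) : Finset ((Fin (n + 1) → ℤ) × Equiv.Perm (Fin (n + 1))) :=
  (simplexSet (n + 1) N).filter (fun p => p.1 0 < 0)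

lemma cnt_half {n : ℕ} {N : ℤ} {l : (Fin (n + 1) → ℤ) → ℕ} (hl : Good (n + 1) N l) (b : Bool) :
    cnt (n + 1) N l b = ∑ p ∈ half n N, ∑ i ∈ Finset.range (n + 2), mpat b (facet l p i) := by
  have h1 : ∀ p ∈ half n N, ∑ i ∈ Finset.range (n + 2), mpat b (facet l p i)
      = mpat b (room l p) + mpat (!b) (room l p) := fun p hp =>
    sum_facet hl b (Finset.mem_filter.1 hp).1
  rw [Finset.sum_congr rfl h1, Finset.sum_add_distrib, cnt,
    ← Finset.sum_filter_add_sum_filter_not _ (fun p => p.1 0 < 0)]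
  congr 1
  have hmem : ∀ p, p ∈ simplexSet (n + 1) N → reflSimplex p ∈ simplexSet (n + 1) N := by
    intro p hp
    rw [mem_simplexSet] at *
    intro m
    have := hp m
    simp only [reflSimplex]
    omega
  apply Finset.sum_nbij' reflSimplex reflSimplex
  · intro p hp
    rw [Finset.mem_filter] at hp
    refine Finset.mem_filter.2 ⟨hmem p hp.1, ?_⟩
    simp only [reflSimplex]
    omega
  · intro p hp
    rw [half, Finset.mem_filter] at hp
    refine Finset.mem_filter.2 ⟨hmem p hp.1, ?_⟩
    simp only [reflSimplex]
    omega
  · intro p _; exact refl_refl p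
  · intro p _; exact refl_refl p
  · intro p hp
    rw [Finset.mem_filter] at hp
    have := room_refl hl hp.1
    rw [this, mpat_neg _ _ (room_nc hl hp.1), Bool.not_not]

lemma sum_middle {n : ℕ} {N : ℤ} (l : (Fin (n + 1) → ℤ) → ℕ) (b : Bool) (i : ℕ) (h0 : 0 < i)
    (hn : i ≤ n) : ∑ p ∈ half n N, mpat b (facet l p i) = 0 := by
  set sw : Equiv.Perm (Fin (n + 1)) := Equiv.swap ⟨i - 1, by omega⟩ ⟨i, by omega⟩ with hsw
  have hval : ∀ a : Fin (n + 1), (sw a : ℕ) =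
      if (a : ℕ) = i - 1 then i else if (a : ℕ) = i then i - 1 else a := by
    intro a
    rw [hsw, Equiv.swap_apply_def]
    simp only [Fin.ext_iff]
    split_ifs <;> rfl
  have hf : ∀ p : (Fin (n + 1) → ℤ) × Equiv.Perm (Fin (n + 1)),
      facet l (p.1, p.2.trans sw) i = facet l p i := by
    intro p
    unfold facet
    apply Multiset.map_congr rfl
    intro t ht
    have ht : t ≠ i := by
      have : t ∈ (Finset.range (n + 2)).erase i := ht
      exact (Finset.mem_erase.1 this).1
    congr 1
    funext m
    simp only [vert, Equiv.trans_apply, hval]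
    split_ifs <;> omega
  refine Finset.sum_involution (fun p _ => (p.1, p.2.trans sw)) ?_ ?_ ?_ ?_
  · intro p _
    rw [hf, z2]
  · intro p _ _ h
    have h1 : p.2.trans sw = p.2 := congrArg Prod.snd h
    have h2 := congrArg (fun e => (e (p.2.symm ⟨i, by omega⟩) : ℕ)) h1
    simp only [Equiv.trans_apply, Equiv.apply_symm_apply, hval] at h2
    split_ifs at h2 <;> omega
  · intro p hp
    simpa [half, mem_simplexSet] using hp
  · intro p _
    ext m
    · rfl
    · simp [hsw]

/-- Pivot across facet `0`. -/
def up {n : ℕ} (p : (Fin (n + 1) → ℤ) × Equiv.Perm (Fin (n + 1))) :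
    (Fin (n + 1) → ℤ) × Equiv.Perm (Fin (n + 1)) :=
  (fun a => p.1 a + if (p.2 a : ℕ) = 0 then 1 else 0, p.2.trans (finRotate (n + 1)).symm)

/-- Pivot across the last facet. -/
def down {n : ℕ} (p : (Fin (n + 1) → ℤ) × Equiv.Perm (Fin (n + 1))) :
    (Fin (n + 1) → ℤ) × Equiv.Perm (Fin (n + 1)) :=
  (fun a => p.1 a - if (p.2 a : ℕ) = n then 1 else 0, p.2.trans (finRotate (n + 1)))

lemma rot_val {n : ℕ} (a : Fin (n + 1)) :
    (finRotate (n + 1) a : ℕ) = (if (a : ℕ) = n then (0 : ℕ) else (a : ℕ) + 1 : ℕ) := by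
  rw [coe_finRotate]
  simp only [Fin.ext_iff, Fin.val_last]

lemma rot_symm_val {n : ℕ} (a : Fin (n + 1)) :
    ((finRotate (n + 1)).symm a : ℕ) = (if (a : ℕ) = 0 then n else (a : ℕ) - 1 : ℕ) := by
  obtain ⟨c, rfl⟩ := (finRotate (n + 1)).surjective a
  rw [Equiv.symm_apply_apply, rot_val]
  have := c.2
  by_cases h : (c : ℕ) = n
  · rw [if_pos h]; simp [h]
  · rw [if_neg h, if_neg (by omega)]; omega

lemma facet_up {n : ℕ} (l : (Fin (n + 1) → ℤ) → ℕ)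
    (p : (Fin (n + 1) → ℤ) × Equiv.Perm (Fin (n + 1))) :
    facet l p 0 = facet l (up p) (n + 1) := by
  unfold facet
  rw [map_val_image (s := (Finset.range (n + 1 + 1)).erase (n + 1)) (fun t => t + 1)]
  · apply Multiset.map_congr rfl
    intro t ht
    have ht : t ≤ n := by
      have : t ∈ (Finset.range (n + 2)).erase (n + 1) := ht
      simp only [Finset.mem_erase, Finset.mem_range] at this
      omega
    congr 1
    funext m
    have := (p.2 m).2
    simp only [vert, up, Equiv.trans_apply, rot_symm_val]
    split_ifs <;> omega
  · intro a _ c _ h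
    simpa using h
  · ext a
    simp only [Finset.mem_image, Finset.mem_range, Finset.mem_erase]
    constructor
    · rintro ⟨c, hc, rfl⟩; omega
    · intro ha; exact ⟨a - 1, by omega, by omega⟩

lemma down_up {n : ℕ} (p : (Fin (n + 1) → ℤ) × Equiv.Perm (Fin (n + 1))) : down (up p) = p := by
  ext m
  · have := (p.2 m).2
    simp only [down, up, Equiv.trans_apply, rot_symm_val]
    split_ifs <;> omega
  · simp [down, up]

lemma up_down {n : ℕ} (p : (Fin (n + 1) → ℤ) × Equiv.Perm (Fin (n + 1))) : up (down p) = p := by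
  ext m
  · have := (p.2 m).2
    simp only [down, up, Equiv.trans_apply, rot_val]
    by_cases h : (p.2 m : ℕ) = n
    · simp [h]
    · simp [h]
  · simp [down, up]

lemma facet_zero {n : ℕ} {N : ℤ} {l : (Fin n → ℤ) → ℕ} (hl : Good n N l) (b : Bool)
    {p : (Fin n → ℤ) × Equiv.Perm (Fin n)} (hp : p ∈ simplexSet n N) (i : ℕ) (m : Fin n)
    (h : ∀ t, t ≤ n → t ≠ i → |vert p.1 p.2 t m| = N) : mpat b (facet l p i) = 0 := by
  by_contra hne
  have := mpat_ne _ _ hne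
  unfold facet at this
  rw [Multiset.mem_map] at this
  obtain ⟨t, ht, h0⟩ := this
  have ht : t ∈ (Finset.range (n + 1)).erase i := ht
  simp only [Finset.mem_erase, Finset.mem_range] at ht
  exact hl.bd _ (vert_mem hp t) m (h t (by omega) ht.1) h0

lemma sum_ends {n : ℕ} {N : ℤ} (hN : 1 ≤ N) {l : (Fin (n + 1) → ℤ) → ℕ}
    (hl : Good (n + 1) N l) (b : Bool) :
    ∑ p ∈ half n N, mpat b (facet l p 0) = ∑ p ∈ half n N, mpat b (facet l p (n + 1))
      + ∑ p ∈ (half n N).filter (fun p => (p.2 0 : ℕ) = 0 ∧ p.1 0 = -1), mpat b (facet l p 0) := by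
  have h1 : ∑ p ∈ half n N, mpat b (facet l p (n + 1))
      = ∑ p ∈ (half n N).filter (fun p => down p ∈ half n N), mpat b (facet l p (n + 1)) := by
    rw [Finset.sum_filter]
    apply Finset.sum_congr rfl
    intro p hp
    rw [half, Finset.mem_filter] at hp
    split_ifs with h
    · rfl
    · set m := p.2.symm (Fin.last n) with hm
      have hm2 : p.2 m = Fin.last n := by simp [hm]
      apply facet_zero hl b hp.1 _ m
      intro t ht hti
      have hp1 := hp.1
      rw [mem_simplexSet] at hp1
      by_cases hx : p.1 m = -N
      · simp only [vert, hm2, hx, Fin.val_last]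
        rw [if_neg (by omega)]
        simp; omega
      · exfalso
        apply h
        rw [half, Finset.mem_filter, mem_simplexSet]
        have hd : ∀ a, (down p).1 a = p.1 a - if a = m then 1 else 0 := by
          intro a
          simp only [down]
          congr 1
          have : (p.2 a : ℕ) = n ↔ a = m := by
            rw [hm, Equiv.eq_symm_apply, Fin.ext_iff]; rfl
          simp only [this]
        constructor
        · intro a
          have h3 := hp1 a
          rw [hd]
          split_ifs with ham
          · subst ham; omega
          · omega
        · rw [hd]
          have := hp.2
          split_ifs <;> omega
  have h2 : ∑ p ∈ (half n N).filter (fun p => down p ∈ half n N), mpat b (facet l p (n + 1))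
      = ∑ p ∈ (half n N).filter (fun p => up p ∈ half n N), mpat b (facet l p 0) := by
    apply Finset.sum_nbij' down up
    · intro p hp
      rw [Finset.mem_filter] at hp ⊢
      rw [up_down]
      exact hp.symm
    · intro p hp
      rw [Finset.mem_filter] at hp ⊢
      rw [down_up]
      exact hp.symm
    · intro p _; exact up_down p
    · intro p _; exact down_up p
    · intro p _
      rw [facet_up, up_down]
  rw [h1, h2, Finset.sum_filter, Finset.sum_filter, ← Finset.sum_add_distrib]
  apply Finset.sum_congr rfl
  intro p hp
  rw [half, Finset.mem_filter] at hp
  have hp1 := hp.1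
  rw [mem_simplexSet] at hp1
  set m := p.2.symm 0 with hm
  have hm2 : p.2 m = 0 := by simp [hm]
  have hd : ∀ a, (up p).1 a = p.1 a + if a = m then 1 else 0 := by
    intro a
    simp only [up]
    congr 1
    have : (p.2 a : ℕ) = 0 ↔ a = m := by
      rw [hm, Equiv.eq_symm_apply, Fin.ext_iff]; rfl
    simp only [this]
  by_cases hflat : (p.2 0 : ℕ) = 0 ∧ p.1 0 = -1
  · have : up p ∉ half n N := by
      rw [half, Finset.mem_filter]
      rintro ⟨_, h⟩
      simp only [up, hflat.1, hflat.2] at h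
      simp at h
    rw [if_neg this, if_pos hflat, zero_add]
  · rw [if_neg hflat, add_zero]
    split_ifs with h
    · rfl
    · apply facet_zero hl b hp.1 _ m
      intro t ht ht0
      by_cases hx : p.1 m + 1 = N
      · simp only [vert, hm2, Fin.val_zero]
        rw [if_pos (by omega), hx]
        exact abs_of_nonneg (by omega)
      · exfalso
        apply h
        rw [half, Finset.mem_filter, mem_simplexSet]
        constructor
        · intro a
          have h3 := hp1 a
          rw [hd]
          split_ifs with ham
          · subst ham; omega
          · omega
        · rw [hd]
          have := hp.2
          split_ifs with h0
          · rw [← h0] at hm2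
            have : p.1 0 ≠ -1 := fun h => hflat ⟨by rw [hm2]; rfl, h⟩
            omega
          · omega

lemma sum_flat {n : ℕ} {N : ℤ} (hN : 1 ≤ N) (l : (Fin (n + 1) → ℤ) → ℕ) (b : Bool) :
    ∑ p ∈ (half n N).filter (fun p => (p.2 0 : ℕ) = 0 ∧ p.1 0 = -1), mpat b (facet l p 0)
      = cnt n N (fun v => l (Fin.cons 0 v)) b := by
  symm
  unfold cnt
  refine Finset.sum_bij' (fun p _ => ((Fin.cons (-1) p.1 : Fin (n + 1) → ℤ),
      Equiv.Perm.decomposeFin.symm (0, p.2)))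
    (fun p _ => (Fin.tail p.1, (Equiv.Perm.decomposeFin p.2).2)) ?_ ?_ ?_ ?_ ?_
  · intro p hp
    rw [mem_simplexSet] at hp
    simp only [half, Finset.mem_filter, mem_simplexSet]
    refine ⟨⟨?_, ?_⟩, ?_, ?_⟩
    · intro m
      refine Fin.cases ?_ (fun a => ?_) m
      · simp only [Fin.cons_zero]; omega
      · simpa using hp a
    · simp
    · simp
    · simp
  · intro p hp
    simp only [half, Finset.mem_filter, mem_simplexSet] at hp
    rw [mem_simplexSet]
    intro m
    exact hp.1.1 m.succ
  · intro p _
    simp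
  · intro p hp
    simp only [half, Finset.mem_filter, mem_simplexSet] at hp
    have h0 : p.2 0 = 0 := Fin.ext hp.2.1
    ext m
    · simp only
      rw [← hp.2.2, Fin.cons_self_tail]
    · simp only
      have : (0, (Equiv.Perm.decomposeFin p.2).2) = Equiv.Perm.decomposeFin p.2 := by
        refine Prod.ext ?_ rfl
        simp only
        have h3 : Equiv.Perm.decomposeFin.symm (Equiv.Perm.decomposeFin p.2) 0
          = (Equiv.Perm.decomposeFin p.2).1 := by
          conv_lhs => rw [← Prod.mk.eta (p := Equiv.Perm.decomposeFin p.2)]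
          rw [Equiv.Perm.decomposeFin_symm_apply_zero]
        rw [Equiv.symm_apply_apply, h0] at h3
        exact h3
      rw [this, Equiv.symm_apply_apply]
  · intro p _
    congr 1
    unfold facet room
    rw [map_val_image (s := Finset.range (n + 1))
      (t := (Finset.range (n + 1 + 1)).erase 0) (fun t => t + 1)]
    · apply Multiset.map_congr rfl
      intro t _
      show l _ = l _
      congr 1
      funext m
      refine Fin.cases ?_ (fun a => ?_) m
      · simp [vert]
      · simp [vert]
    · intro a _ c _ h
      simpa using h
    · ext a
      simp only [Finset.mem_image, Finset.mem_range, Finset.mem_erase]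
      constructor
      · rintro ⟨c, hc, rfl⟩; omega
      · intro ha; exact ⟨a - 1, by omega, by omega⟩

lemma cnt_succ {n : ℕ} {N : ℤ} (hN : 1 ≤ N) {l : (Fin (n + 1) → ℤ) → ℕ}
    (hl : Good (n + 1) N l) (b : Bool) :
    cnt (n + 1) N l b = cnt n N (fun v => l (Fin.cons 0 v)) b := by
  rw [cnt_half hl, Finset.sum_comm, Finset.sum_range_succ, Finset.sum_range_succ',
    Finset.sum_eq_zero, zero_add, sum_ends hN hl, sum_flat hN]
  · rw [add_comm, ← add_assoc, z2, zero_add]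
  · intro i hi
    rw [Finset.mem_range] at hi
    exact sum_middle l b (i + 1) (by omega) (by omega)

lemma good_cons {n : ℕ} {N : ℤ} (hN : 1 ≤ N) {l : (Fin (n + 1) → ℤ) → ℕ}
    (hl : Good (n + 1) N l) : Good n N (fun v => l (Fin.cons 0 v)) := by
  have hb : ∀ u : Fin n → ℤ, (∀ m, |u m| ≤ N) →
      ∀ m, |(Fin.cons 0 u : Fin (n + 1) → ℤ) m| ≤ N := by
    intro u hu m
    refine Fin.cases ?_ (fun a => ?_) m
    · simp; omega
    · simpa using hu a
  refine ⟨?_, ?_, ?_⟩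
  · intro u v hu hv huv
    refine hl.nc _ _ (hb u hu) (hb v hv) ?_
    intro m
    refine Fin.cases ?_ (fun a => ?_) m
    · simp
    · simpa using huv a
  · intro u hu
    rw [← hl.odd _ (hb u hu)]
    congr 1
    funext m
    refine Fin.cases ?_ (fun a => ?_) m
    · simp
    · simp
  · intro u hu m hm
    exact hl.bd _ (hb u hu) m.succ (by simpa using hm)

lemma cnt_one (n : ℕ) {N : ℤ} (hN : 1 ≤ N) (l : (Fin n → ℤ) → ℕ)
    (hl : Good n N l) (h0 : l 0 = 0) (b : Bool) : cnt n N l b = 1 := by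
  induction n with
  | zero =>
    have h1 : simplexSet 0 N = {(0, 1)} := by
      ext p
      simp only [mem_simplexSet, Finset.mem_singleton]
      constructor
      · intro _; exact Subsingleton.elim _ _
      · intro _ m; exact m.elim0
    rw [cnt, h1, Finset.sum_singleton]
    have : room l (0, 1) = ([0] : List ℕ) := by
      unfold room
      have : vert (0 : Fin 0 → ℤ) 1 0 = 0 := Subsingleton.elim _ _
      simp only [zero_add, Finset.range_one, Finset.singleton_val, Multiset.map_singleton]
      rw [this, h0]; rfl
    rw [this, mpat, sort_unique _ (by simp)]
    simp [pat, alt]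
  | succ n ih =>
    rw [cnt_succ hN hl]
    apply ih _ (good_cons hN hl)
    rw [← h0]
    congr 1
    funext m
    refine Fin.cases ?_ (fun a => ?_) m <;> simp

/-- Combinatorial Borsuk–Ulam type lemma. -/
lemma combinatorial (n d : ℕ) (hd : d < n) {N : ℤ} (hN : 1 ≤ N) (l : (Fin n → ℤ) → ℕ)
    (hl : Good n N l) (h0 : l 0 = 0) (hbd : ∀ u, l u / 2 ≤ d) : False := by
  have h1 := cnt_one n hN l hl h0 true
  have h2 : cnt n N l true = 0 := by
    apply Finset.sum_eq_zero
    intro p hp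
    by_contra hne
    have := mpat_bound d true (room l p) (room_nc hl hp) (by
      intro a ha
      unfold room at ha
      rw [Multiset.mem_map] at ha
      obtain ⟨s, -, rfl⟩ := ha
      exact hbd _) hne
    simp only [room, Multiset.card_map, Finset.card_val, Finset.card_range] at this
    omega
  rw [h1] at h2
  exact one_ne_zero h2

/-! ### Part 3: the continuous Borsuk–Ulam type lemma -/

open Classical in
/-- A choice of an index satisfying a predicate. -/
noncomputable def sel {d : ℕ} (Q : Fin d → Prop) : Option (Fin d) :=
  if h : ∃ i, Q i then some h.choose else none

lemma sel_some {d : ℕ} {Q : Fin d → Prop} {i : Fin d} (h : sel Q = some i) : Q i := by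
  unfold sel at h
  split_ifs at h with h1
  have := h1.choose_spec
  simp only [Option.some.injEq] at h
  rwa [h] at this

lemma sel_none {d : ℕ} {Q : Fin d → Prop} (h : sel Q = none) (i : Fin d) : ¬ Q i := by
  unfold sel at h
  split_ifs at h with h1
  exact fun h2 => h1 ⟨i, h2⟩

open Classical in
/-- The labelling induced by `f` and `g`. -/
noncomputable def lab {n d : ℕ} (f : (Fin n → ℝ) → (Fin d → ℝ)) (g : (Fin n → ℝ) → ℝ) (ε : ℝ)
    (x : Fin n → ℝ) : ℕ :=
  match sel (fun i => ε ≤ |f x i|) with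
  | some i => if 0 < f x i then 2 * ((i : ℕ) + 1) else 2 * ((i : ℕ) + 1) + 1
  | none => if g x < 0 then 0 else 1

lemma lab_cases {n d : ℕ} (f : (Fin n → ℝ) → (Fin d → ℝ)) (g : (Fin n → ℝ) → ℝ) (ε : ℝ)
    (x : Fin n → ℝ) (hε : 0 < ε) :
    (∃ i : Fin d, sel (fun i => ε ≤ |f x i|) = some i ∧ ε ≤ f x i ∧
      lab f g ε x = 2 * ((i : ℕ) + 1)) ∨
    (∃ i : Fin d, sel (fun i => ε ≤ |f x i|) = some i ∧ f x i ≤ -ε ∧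
      lab f g ε x = 2 * ((i : ℕ) + 1) + 1) ∨
    (sel (fun i => ε ≤ |f x i|) = none ∧ ‖f x‖ < ε ∧ g x < 0 ∧ lab f g ε x = 0) ∨
    (sel (fun i => ε ≤ |f x i|) = none ∧ ‖f x‖ < ε ∧ 0 ≤ g x ∧ lab f g ε x = 1) := by
  unfold lab
  cases hs : sel (fun i => ε ≤ |f x i|) with
  | some i =>
    have := sel_some hs
    by_cases h : 0 < f x i
    · left
      refine ⟨i, rfl, ?_, by simp [h]⟩
      rwa [abs_of_pos h] at this
    · right; left
      refine ⟨i, rfl, ?_, by simp [h]⟩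
      rw [abs_of_nonpos (not_lt.1 h)] at this
      linarith
  | none =>
    have hn : ‖f x‖ < ε := by
      rw [pi_norm_lt_iff hε]
      intro i
      exact not_le.1 (sel_none hs i)
    right; right
    by_cases h : g x < 0
    · left; exact ⟨rfl, hn, h, by simp [h]⟩
    · right; exact ⟨rfl, hn, not_lt.1 h, by simp [h]⟩

lemma topo {n d : ℕ} (hd : d < n) (f : (Fin n → ℝ) → (Fin d → ℝ)) (hf : Continuous f)
    (hodd : ∀ x, f (-x) = - f x) (g : (Fin n → ℝ) → ℝ) (hg : Continuous g)
    (heven : ∀ x, g (-x) = g x) (hg0 : g 0 < 0) (R : ℝ) (hR : 0 < R)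
    (hgR : ∀ x, R ≤ ‖x‖ → 0 < g x) : ∃ x, f x = 0 ∧ g x = 0 := by
  by_contra hcon
  have hK : IsCompact (Metric.closedBall (0 : Fin n → ℝ) R) := isCompact_closedBall _ _
  obtain ⟨ε, hε, hεK⟩ : ∃ ε > 0, ∀ x ∈ Metric.closedBall (0 : Fin n → ℝ) R,
      ‖f x‖ < ε → ε ≤ |g x| := by
    obtain ⟨x0, -, hx0⟩ := hK.exists_isMinOn (f := fun x => max ‖f x‖ |g x|)
      ⟨0, by simp [hR.le]⟩ (by fun_prop)
    refine ⟨max ‖f x0‖ |g x0|, ?_, ?_⟩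
    · by_contra hle
      rw [not_lt, max_le_iff] at hle
      exact hcon ⟨x0, norm_le_zero_iff.1 hle.1, abs_nonpos_iff.1 hle.2⟩
    · intro x hx hlt
      have h1 : max ‖f x0‖ |g x0| ≤ max ‖f x‖ |g x| := hx0 hx
      rcases le_max_iff.1 h1 with h | h
      · linarith
      · exact h
  have huf := hK.uniformContinuousOn_of_continuous hf.continuousOn
  have hug := hK.uniformContinuousOn_of_continuous hg.continuousOn
  rw [Metric.uniformContinuousOn_iff] at huf hug
  obtain ⟨δ1, hδ1, h1⟩ := huf ε hε
  obtain ⟨δ2, hδ2, h2⟩ := hug ε hε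
  obtain ⟨N, hN⟩ := exists_nat_gt (R / min δ1 δ2)
  have hδ : 0 < min δ1 δ2 := lt_min hδ1 hδ2
  have hN0 : (0 : ℝ) < N := lt_trans (by positivity) hN
  have hs : R / N < min δ1 δ2 := by
    rw [div_lt_iff₀ hN0]
    rw [div_lt_iff₀ hδ] at hN
    linarith
  have hs0 : 0 < R / N := by positivity
  set s := R / N with hsdef
  have hsN : s * N = R := by rw [hsdef]; field_simp
  let pt : (Fin n → ℤ) → (Fin n → ℝ) := fun u m => s * (u m : ℝ)
  have hptK : ∀ u : Fin n → ℤ, (∀ m, |u m| ≤ (N : ℤ)) → pt u ∈ Metric.closedBall (0 : Fin n → ℝ) R := by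
    intro u hu
    rw [mem_closedBall_zero_iff, pi_norm_le_iff_of_nonneg hR.le]
    intro m
    have : |(u m : ℝ)| ≤ N := by exact_mod_cast hu m
    simp only [pt, Real.norm_eq_abs, abs_mul, abs_of_pos hs0]
    rw [← hsN]
    gcongr
  have hptneg : ∀ u, pt (-u) = - pt u := by
    intro u; funext m; simp [pt]
  have hadj : ∀ u v : Fin n → ℤ, (∀ m, |u m - v m| ≤ 1) → dist (pt u) (pt v) < min δ1 δ2 := by
    intro u v huv
    refine lt_of_le_of_lt ?_ hs
    rw [dist_pi_le_iff hs0.le]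
    intro m
    have : |(u m : ℝ) - v m| ≤ 1 := by exact_mod_cast huv m
    simp only [pt, Real.dist_eq, ← mul_sub, abs_mul, abs_of_pos hs0]
    nlinarith
  have hN1 : (1 : ℤ) ≤ N := by
    have : 0 < N := by exact_mod_cast hN0
    omega
  refine combinatorial n d hd hN1 (fun u => lab f g ε (pt u)) ⟨?_, ?_, ?_⟩ ?_ ?_
  · intro u v hu hv huv heq
    have hd := hadj u v huv
    have hdf := h1 _ (hptK u hu) _ (hptK v hv) (lt_of_lt_of_le hd (min_le_left _ _))
    have hdg := h2 _ (hptK u hu) _ (hptK v hv) (lt_of_lt_of_le hd (min_le_right _ _))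
    have hgu := hεK _ (hptK u hu)
    have hgv := hεK _ (hptK v hv)
    have hcoord : ∀ i, |f (pt u) i - f (pt v) i| < ε := by
      intro i
      exact lt_of_le_of_lt (dist_le_pi_dist (f (pt u)) (f (pt v)) i) hdf
    rw [Real.dist_eq, abs_lt] at hdg
    rcases lab_cases f g ε (pt u) hε with ⟨i, -, hi, hl⟩ | ⟨i, -, hi, hl⟩ | ⟨-, hi, hg', hl⟩ |
      ⟨-, hi, hg', hl⟩ <;>
    rcases lab_cases f g ε (pt v) hε with ⟨j, -, hj, hl'⟩ | ⟨j, -, hj, hl'⟩ | ⟨-, hj, hg'', hl'⟩ |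
      ⟨-, hj, hg'', hl'⟩ <;> rw [hl, hl'] at heq <;> rw [hl, hl'] <;> try omega
    · have : i = j := Fin.ext (by omega)
      subst this
      have := abs_lt.1 (hcoord i)
      linarith
    · have : i = j := Fin.ext (by omega)
      subst this
      have := abs_lt.1 (hcoord i)
      linarith
    · have h3 := hgu hi
      have h4 := hgv hj
      rw [abs_of_neg hg'] at h3
      rw [abs_of_nonneg hg''] at h4
      linarith
    · have h3 := hgu hi
      have h4 := hgv hj
      rw [abs_of_nonneg hg'] at h3
      rw [abs_of_neg hg''] at h4
      linarith
  · intro u hu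
    simp only [hptneg]
    have hsel : (fun i => ε ≤ |f (-pt u) i|) = (fun i => ε ≤ |f (pt u) i|) := by
      funext i; rw [hodd]; simp
    have hL := lab_cases f g ε (-pt u) hε
    rw [hsel] at hL
    simp only [hodd, heven, Pi.neg_apply, norm_neg] at hL
    rcases lab_cases f g ε (pt u) hε with ⟨i, hs, hi, hl⟩ | ⟨i, hs, hi, hl⟩ | ⟨hs, hi, hg', hl⟩ |
      ⟨hs, hi, hg', hl⟩ <;>
    rcases hL with ⟨j, hs', hj, hl'⟩ | ⟨j, hs', hj, hl'⟩ | ⟨hs', hj, hg'', hl'⟩ |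
      ⟨hs', hj, hg'', hl'⟩ <;> rw [hl, hl'] <;> rw [hs] at hs' <;>
      simp only [Option.some.injEq, reduceCtorEq] at hs' <;> try subst hs'
    · linarith
    · unfold neg; grind
    · unfold neg; grind
    · linarith
    · rfl
    · linarith
    · linarith
    · rfl
  · intro u hu m hm h0
    have : R ≤ ‖pt u‖ := by
      refine le_trans ?_ (norm_le_pi_norm (pt u) m)
      have : |(u m : ℝ)| = N := by exact_mod_cast hm
      simp only [pt, Real.norm_eq_abs, abs_mul, abs_of_pos hs0]
      rw [this, hsN]
    have := hgR _ this
    rcases lab_cases f g ε (pt u) hε with ⟨i, hs, hi, hl⟩ | ⟨i, hs, hi, hl⟩ | ⟨hs, hi, hg', hl⟩ |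
      ⟨hs, hi, hg', hl⟩
    · simp only [hl] at h0; omega
    · simp only [hl] at h0; omega
    · linarith
    · simp only [hl] at h0; omega
  · have hp0 : pt 0 = 0 := by funext m; simp [pt]
    have hf0 : f 0 = 0 := by
      have := hodd 0
      rw [neg_zero] at this
      exact self_eq_neg.1 this
    simp only [hp0]
    rcases lab_cases f g ε 0 hε with ⟨i, hs, hi, hl⟩ | ⟨i, hs, hi, hl⟩ | ⟨hs, hi, hg', hl⟩ |
      ⟨hs, hi, hg', hl⟩
    · rw [hf0] at hi; simp at hi; linarith
    · rw [hf0] at hi; simp at hi; linarith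
    · exact hl
    · linarith
  · intro u
    rcases lab_cases f g ε (pt u) hε with ⟨i, hs, hi, hl⟩ | ⟨i, hs, hi, hl⟩ | ⟨hs, hi, hg', hl⟩ |
      ⟨hs, hi, hg', hl⟩ <;> rw [hl]
    · have := i.2; omega
    · have := i.2; omega
    · omega
    · omega

/-! ### Part 4: variational part -/

lemma caristi {E : Type*} [MetricSpace E] [CompleteSpace E] (φ : E → ℝ) (hφ : Continuous φ)
    (h0 : ∀ x, 0 ≤ φ x) (c : ℝ) (hc : 0 < c) (x0 : E)
    (H : ∀ x, ∃ y, y ≠ x ∧ φ y + c * dist x y ≤ φ x) : False := by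
  have hch : ∀ (n : ℕ) (x : E), ∃ y, φ y + c * dist x y ≤ φ x ∧
      ∀ z, φ z + c * dist x z ≤ φ x → φ y ≤ φ z + (1 / 2 : ℝ) ^ n := by
    intro n x
    have hne : (φ '' {z | φ z + c * dist x z ≤ φ x}).Nonempty := ⟨φ x, x, by simp, rfl⟩
    have hbd : BddBelow (φ '' {z | φ z + c * dist x z ≤ φ x}) :=
      ⟨0, by rintro _ ⟨z, -, rfl⟩; exact h0 z⟩
    obtain ⟨_, ⟨y, hy, rfl⟩, hlt⟩ := exists_lt_of_csInf_lt hne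
      (lt_add_of_pos_right _ (by positivity : (0 : ℝ) < (1 / 2) ^ n))
    refine ⟨y, hy, fun z hz => ?_⟩
    have := csInf_le hbd ⟨z, hz, rfl⟩
    linarith
  choose F hF1 hF2 using hch
  let x : ℕ → E := fun n => Nat.rec x0 (fun n y => F n y) n
  have hx : ∀ n, x (n + 1) = F n (x n) := fun n => rfl
  have hstep : ∀ n, φ (x (n + 1)) + c * dist (x n) (x (n + 1)) ≤ φ (x n) := by
    intro n; rw [hx]; exact hF1 n (x n)
  have hsum : ∀ n, ∑ i ∈ Finset.range n, dist (x i) (x (i + 1)) ≤ φ x0 / c := by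
    intro n
    have : φ (x n) + c * ∑ i ∈ Finset.range n, dist (x i) (x (i + 1)) ≤ φ x0 := by
      induction n with
      | zero => simp [x]
      | succ n ih =>
        rw [Finset.sum_range_succ]
        have := hstep n
        nlinarith
    rw [le_div_iff₀ hc]
    have := h0 (x n)
    linarith
  have hcau : CauchySeq x :=
    cauchySeq_of_summable_dist (summable_of_sum_range_le (fun _ => dist_nonneg) hsum)
  obtain ⟨a, ha⟩ := cauchySeq_tendsto_of_complete hcau
  have hmn : ∀ n k, φ (x (n + k)) + c * dist (x n) (x (n + k)) ≤ φ (x n) := by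
    intro n k
    induction k with
    | zero => simp
    | succ k ih =>
      have h1 := hstep (n + k)
      have h2 := dist_triangle (x n) (x (n + k)) (x (n + k + 1))
      rw [← add_assoc]
      nlinarith
  have ha1 : ∀ n, φ a + c * dist (x n) a ≤ φ (x n) := by
    intro n
    have ht : Tendsto (fun k => x (n + k)) atTop (𝓝 a) := by
      have := (tendsto_add_atTop_iff_nat n).2 ha
      simpa [add_comm] using this
    have h1 : Tendsto (fun k => φ (x (n + k)) + c * dist (x n) (x (n + k))) atTop
        (𝓝 (φ a + c * dist (x n) a)) :=
      ((hφ.tendsto a).comp ht).add ((tendsto_const_nhds.dist ht).const_mul c)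
    exact le_of_tendsto' h1 (hmn n)
  obtain ⟨y, hya, hy⟩ := H a
  have hyn : ∀ n, φ a ≤ φ y + (1 / 2 : ℝ) ^ n := by
    intro n
    have h1 := ha1 n
    have h2 := dist_triangle (x n) a y
    have h3 := hF2 n (x n) y (by nlinarith)
    have h4 := ha1 (n + 1)
    rw [← hx] at h3
    have : 0 ≤ c * dist (x (n + 1)) a := by positivity
    linarith
  have hlim : Tendsto (fun n : ℕ => φ y + (1 / 2 : ℝ) ^ n) atTop (𝓝 (φ y + 0)) :=
    tendsto_const_nhds.add (tendsto_pow_atTop_nhds_zero_of_lt_one (by norm_num) (by norm_num))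
  have h5 := ge_of_tendsto' hlim hyn
  have h6 : 0 < dist a y := dist_pos.2 (Ne.symm hya)
  have : 0 < c * dist a y := by positivity
  linarith

lemma dJ_odd {X : Type*} [NormedAddCommGroup X] [NormedSpace ℝ X]
    (J : X → ℝ) (dJ : X → X →L[ℝ] ℝ) (hdJ : ∀ u, HasFDerivAt J (dJ u) u)
    (heven : ∀ u, J (-u) = J u) (u : X) : dJ (-u) = - dJ u := by
  have h1 : HasFDerivAt (fun v => J (-v)) ((dJ (-u)).comp (-ContinuousLinearMap.id ℝ X)) u :=
    (hdJ (-u)).comp u ((hasFDerivAt_id u).neg)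
  have h2 : (fun v => J (-v)) = J := funext heven
  rw [h2] at h1
  have h3 := h1.unique (hdJ u)
  rw [← h3]
  ext v
  simp

lemma improve {X : Type*} [NormedAddCommGroup X] [NormedSpace ℝ X]
    (J : X → ℝ) (dJ : X → X →L[ℝ] ℝ)
    (hdJ : ∀ u, HasFDerivAt J (dJ u) u) (hdJc : Continuous dJ)
    (heven : ∀ u, J (-u) = J u)
    {B : Type*} [MetricSpace B] [CompactSpace B] (σ : B → B) (hσ : Continuous σ)
    (hσσ : ∀ s, σ (σ s) = s)
    (γ : C(B, X)) (hγ : ∀ s, γ (σ s) = - γ s) (m M κ : ℝ) (hMm : M < m) (hκ : 0 < κ)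
    (hle : ∀ s, J (γ s) ≤ m) (hlow : ∀ s, M ≤ J (γ s) → κ ≤ ‖dJ (γ s)‖) :
    ∃ γ' : C(B, X), (∀ s, γ' (σ s) = - γ' s) ∧ (∀ s, J (γ s) ≤ M → γ' s = γ s) ∧
      ∃ h : ℝ, 0 < h ∧ h ≤ 1 ∧ dist γ γ' ≤ h ∧ ∀ s, J (γ' s) ≤ m - κ / 4 * h := by
  have hJc : Continuous J := continuous_iff_continuousAt.2 fun u => (hdJ u).continuousAt
  -- the local direction field
  obtain ⟨W, hW⟩ : ∃ W : C(B, X), ∀ s, W s ∈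
      {w : X | ‖w‖ ≤ 1 ∧ (M ≤ J (γ s) → κ / 2 ≤ dJ (γ s) w)} := by
    apply exists_continuous_forall_mem_convex_of_local_const
    · intro s
      have h1 : Convex ℝ {w : X | ‖w‖ ≤ 1} := by
        have := convex_closedBall (0 : X) 1
        convert this using 1
        ext w; simp
      have h2 : Convex ℝ {w : X | M ≤ J (γ s) → κ / 2 ≤ dJ (γ s) w} := by
        by_cases h : M ≤ J (γ s)
        · simp only [h, forall_true_left]
          exact convex_halfSpace_ge (dJ (γ s)).toLinearMap.isLinear _
        · simp only [h, false_imp_iff]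
          exact convex_univ
      exact h1.inter h2
    · intro s
      by_cases h : M ≤ J (γ s)
      · obtain ⟨w, hw1, hw2⟩ := (dJ (γ s)).exists_lt_apply_of_lt_opNorm
          (lt_of_lt_of_le (by linarith : κ / 2 < κ) (hlow s h))
        obtain ⟨w', hw1', hw2'⟩ : ∃ w' : X, ‖w'‖ ≤ 1 ∧ κ / 2 < dJ (γ s) w' := by
          rw [Real.norm_eq_abs, lt_abs] at hw2
          rcases hw2 with h | h
          · exact ⟨w, hw1.le, h⟩
          · exact ⟨-w, by simpa using hw1.le, by simpa using h⟩
        refine ⟨w', ?_⟩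
        have hcont : Continuous (fun y => dJ (γ y) w') := by fun_prop
        filter_upwards [hcont.continuousAt.eventually (lt_mem_nhds hw2')] with y hy
        exact ⟨hw1', fun _ => hy.le⟩
      · refine ⟨0, ?_⟩
        have hcont : Continuous (fun y => J (γ y)) := by fun_prop
        filter_upwards [hcont.continuousAt.eventually (gt_mem_nhds (not_le.1 h))] with y hy
        exact ⟨by simp, fun h' => absurd hy (not_lt.2 h')⟩
  -- uniform continuity near the image
  have hK : IsCompact (Set.range γ) := isCompact_range γ.continuous
  obtain ⟨h0, hh0, hunif⟩ : ∃ h0 > 0, ∀ s, ∀ y, dist (γ s) y < h0 →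
      ‖dJ y - dJ (γ s)‖ ≤ κ / 4 := by
    have h1 := hK.uniformContinuousAt_of_continuousAt dJ (fun a _ => hdJc.continuousAt)
      (Metric.dist_mem_uniformity (by positivity : 0 < κ / 4))
    obtain ⟨ε, hε, h2⟩ := Metric.mem_uniformity_dist.1 h1
    refine ⟨ε, hε, fun s y hy => ?_⟩
    have h3 := h2 hy (Set.mem_range_self s)
    have h4 : dist (dJ (γ s)) (dJ y) < κ / 4 := h3
    rw [dist_comm, dist_eq_norm] at h4
    exact h4.le
  set h : ℝ := min 1 (min (h0 / 2) (2 * (m - M) / κ)) with hh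
  have hMm' : 0 < m - M := by linarith
  have hpos : 0 < h := by
    rw [hh]; refine lt_min one_pos (lt_min (by positivity) (by positivity))
  have hle1 : h ≤ 1 := min_le_left _ _
  have hle2 : h ≤ h0 / 2 := (min_le_right _ _).trans (min_le_left _ _)
  have hle3 : h ≤ 2 * (m - M) / κ := (min_le_right _ _).trans (min_le_right _ _)
  let χ : B → ℝ := fun s => min 1 (max 0 (2 * (J (γ s) - M) / (m - M)))
  have hχc : Continuous χ := by fun_prop
  have hχ0 : ∀ s, 0 ≤ χ s := fun s => le_min zero_le_one (le_max_left _ _)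
  have hχ1 : ∀ s, χ s ≤ 1 := fun s => min_le_left _ _
  have hχσ : ∀ s, χ (σ s) = χ s := by
    intro s; simp only [χ, hγ, heven]
  have hχM : ∀ s, J (γ s) ≤ M → χ s = 0 := by
    intro s hs
    have : 2 * (J (γ s) - M) / (m - M) ≤ 0 :=
      div_nonpos_of_nonpos_of_nonneg (by linarith) hMm'.le
    simp only [χ]
    rw [max_eq_left this]; simp
  have hχm : ∀ s, (m + M) / 2 ≤ J (γ s) → χ s = 1 := by
    intro s hs
    have : 1 ≤ 2 * (J (γ s) - M) / (m - M) := by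
      rw [le_div_iff₀ hMm']; linarith
    simp only [χ]
    exact min_eq_left (this.trans (le_max_right _ _))
  let V : B → X := fun s => (1 / 2 : ℝ) • (W s - W (σ s))
  have hVc : Continuous V := by fun_prop
  have hVσ : ∀ s, V (σ s) = - V s := by
    intro s; simp only [V, hσσ]; rw [← smul_neg, neg_sub]
  have hV1 : ∀ s, ‖V s‖ ≤ 1 := by
    intro s
    have h1 := (hW s).1
    have h2 := (hW (σ s)).1
    have h3 := norm_sub_le (W s) (W (σ s))
    simp only [V, norm_smul]
    norm_num
    linarith
  have hVd : ∀ s, M ≤ J (γ s) → κ / 2 ≤ dJ (γ s) (V s) := by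
    intro s hs
    have h1 := (hW s).2 hs
    have h2 := (hW (σ s)).2 (by rw [hγ, heven]; exact hs)
    rw [hγ, dJ_odd J dJ hdJ heven] at h2
    simp only [V, map_smul, map_sub, smul_eq_mul]
    simp only [ContinuousLinearMap.neg_apply] at h2
    linarith
  refine ⟨⟨fun s => γ s - (h * χ s) • V s, by fun_prop⟩, ?_, ?_, h, hpos, hle1, ?_, ?_⟩
  · intro s
    simp only [ContinuousMap.coe_mk, hγ, hχσ, hVσ]
    rw [smul_neg]; abel
  · intro s hs
    simp [hχM s hs]
  · rw [ContinuousMap.dist_le hpos.le]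
    intro s
    simp only [ContinuousMap.coe_mk, dist_eq_norm, sub_sub_cancel, norm_smul, Real.norm_eq_abs]
    rw [abs_of_nonneg (mul_nonneg hpos.le (hχ0 s))]
    have h1 := hV1 s
    have h2 := hχ1 s
    have h3 := hχ0 s
    calc h * χ s * ‖V s‖ ≤ h * 1 * 1 := by gcongr
      _ = h := by ring
  · intro s
    simp only [ContinuousMap.coe_mk]
    have hκh : κ / 4 * h ≤ (m - M) / 2 := by
      rw [le_div_iff₀ hκ] at hle3
      linarith
    by_cases hs : M ≤ J (γ s)
    · have hnorm : ‖(h * χ s) • V s‖ ≤ h * χ s := by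
        rw [norm_smul, Real.norm_eq_abs, abs_of_nonneg (mul_nonneg hpos.le (hχ0 s))]
        exact mul_le_of_le_one_right (mul_nonneg hpos.le (hχ0 s)) (hV1 s)
      have hnorm2 : h * χ s ≤ h := mul_le_of_le_one_right hpos.le (hχ1 s)
      have hmv := (convex_ball (γ s) h0).norm_image_sub_le_of_norm_hasFDerivWithin_le'
        (f := J) (f' := dJ) (φ := dJ (γ s)) (C := κ / 4)
        (fun y _ => (hdJ y).hasFDerivWithinAt)
        (fun y hy => hunif s y (by rw [dist_comm]; exact hy))
        (Metric.mem_ball_self hh0)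
        (show γ s - (h * χ s) • V s ∈ Metric.ball (γ s) h0 by
          rw [Metric.mem_ball, dist_eq_norm, sub_sub_cancel_left, norm_neg]
          linarith)
      rw [sub_sub_cancel_left, norm_neg, Real.norm_eq_abs] at hmv
      have h1 := (abs_le.1 hmv).2
      rw [map_neg, map_smul, smul_eq_mul] at h1
      have h2 := hVd s hs
      have h3 : h * χ s * (κ / 2) ≤ h * χ s * dJ (γ s) (V s) :=
        mul_le_mul_of_nonneg_left h2 (mul_nonneg hpos.le (hχ0 s))
      have h4 : κ / 4 * ‖(h * χ s) • V s‖ ≤ κ / 4 * (h * χ s) :=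
        mul_le_mul_of_nonneg_left hnorm (by positivity)
      have h5 : J (γ s - (h * χ s) • V s) ≤ J (γ s) - κ / 4 * (h * χ s) := by linarith
      by_cases hs2 : (m + M) / 2 ≤ J (γ s)
      · rw [hχm s hs2, mul_one] at h5
        rw [hχm s hs2, mul_one]
        have := hle s
        linarith
      · have : 0 ≤ κ / 4 * (h * χ s) := mul_nonneg (by positivity) (mul_nonneg hpos.le (hχ0 s))
        linarith
    · rw [hχM s (not_le.1 hs).le]
      simp only [mul_zero, zero_smul, sub_zero]
      linarith

lemma minimax {X : Type*} [NormedAddCommGroup X] [NormedSpace ℝ X] [CompleteSpace X]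
    (J : X → ℝ) (dJ : X → X →L[ℝ] ℝ)
    (hdJ : ∀ u, HasFDerivAt J (dJ u) u) (hdJc : Continuous dJ)
    (heven : ∀ u, J (-u) = J u)
    {B : Type*} [MetricSpace B] [CompactSpace B] [Nonempty B] (σ : B → B) (hσ : Continuous σ)
    (hσσ : ∀ s, σ (σ s) = s) (D : Set B) (γ₀ : C(B, X)) (hγ₀ : ∀ s, γ₀ (σ s) = - γ₀ s)
    (M b β : ℝ) (hM : 0 ≤ M) (hβ : 0 < β) (hD : ∀ s ∈ D, J (γ₀ s) ≤ M)
    (hb : ∀ s, J (γ₀ s) ≤ b)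
    (hlow : ∀ u, M ≤ J u → J u ≤ b → β ≤ ‖dJ u‖ * (1 + ‖u‖))
    (hlink : ∀ γ : C(B, X), (∀ s, γ (σ s) = - γ s) → (∀ s ∈ D, γ s = γ₀ s) →
      ∃ s, M < J (γ s)) : False := by
  have hJc : Continuous J := continuous_iff_continuousAt.2 fun u => (hdJ u).continuousAt
  let G : Set C(B, X) := {γ | (∀ s, γ (σ s) = - γ s) ∧ (∀ s ∈ D, γ s = γ₀ s) ∧ ∀ s, J (γ s) ≤ b}
  have hev : ∀ s : B, Continuous (fun γ : C(B, X) => γ s) := fun s => continuous_eval_const s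
  have hG : IsClosed G := by
    have h1 : IsClosed {γ : C(B, X) | ∀ s, γ (σ s) = - γ s} := by
      simp only [Set.setOf_forall]
      exact isClosed_iInter fun s => isClosed_eq (hev _) (hev _).neg
    have h2 : IsClosed {γ : C(B, X) | ∀ s ∈ D, γ s = γ₀ s} := by
      simp only [Set.setOf_forall]
      exact isClosed_iInter fun s => isClosed_iInter fun _ => isClosed_eq (hev _) continuous_const
    have h3 : IsClosed {γ : C(B, X) | ∀ s, J (γ s) ≤ b} := by
      simp only [Set.setOf_forall]
      exact isClosed_iInter fun s => isClosed_le (hJc.comp (hev _)) continuous_const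
    exact h1.inter (h2.inter h3)
  haveI : CompleteSpace G := hG.completeSpace_coe
  let Ψ : C(B, X) → ℝ := fun γ => sSup ((fun s => J (γ s)) '' Set.univ)
  have hΨc : Continuous Ψ := by
    apply IsCompact.continuous_sSup isCompact_univ
    exact hJc.comp continuous_eval
  have hbdd : ∀ γ : C(B, X), BddAbove ((fun s => J (γ s)) '' Set.univ) := fun γ =>
    (isCompact_univ.image (by fun_prop)).bddAbove
  have hΨge : ∀ (γ : C(B, X)) s, J (γ s) ≤ Ψ γ := fun γ s =>
    le_csSup (hbdd γ) ⟨s, trivial, rfl⟩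
  have hΨle : ∀ (γ : C(B, X)) (c : ℝ), (∀ s, J (γ s) ≤ c) → Ψ γ ≤ c := by
    intro γ c hc
    apply csSup_le (Set.univ_nonempty.image _)
    rintro _ ⟨s, -, rfl⟩
    exact hc s
  set α := β / 4 with hα
  have hα0 : 0 < α := by positivity
  let Φ : G → ℝ := fun γ => (1 + ‖γ.1‖) * Real.exp (2 * Ψ γ.1 / α)
  have hΦc : Continuous Φ := by fun_prop
  refine caristi Φ hΦc (fun γ => by positivity) (1 / 2) (by norm_num)
    ⟨γ₀, hγ₀, fun _ _ => rfl, hb⟩ ?_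
  rintro ⟨γ, hγ⟩
  obtain ⟨s0, hs0⟩ := hlink γ hγ.1 hγ.2.1
  have hMm : M < Ψ γ := lt_of_lt_of_le hs0 (hΨge γ s0)
  have hn : 0 < 1 + ‖γ‖ := by positivity
  obtain ⟨γ', hodd, hfix, h, hpos, hle1, hdist, hdec⟩ := improve J dJ hdJ hdJc heven σ hσ hσσ γ hγ.1
    (Ψ γ) M (β / (1 + ‖γ‖)) hMm (by positivity) (hΨge γ) (by
      intro s hs
      rw [div_le_iff₀ hn]
      refine (hlow (γ s) hs (hγ.2.2 s)).trans ?_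
      have := γ.norm_coe_le_norm s
      gcongr)
  have hdec2 : Ψ γ' ≤ Ψ γ - α * (h / (1 + ‖γ‖)) := by
    refine (hΨle γ' _ hdec).trans (le_of_eq ?_)
    rw [hα]; field_simp
  have hlt : Ψ γ' < Ψ γ := by
    have : 0 < α * (h / (1 + ‖γ‖)) := by positivity
    linarith
  refine ⟨⟨γ', hodd, ?_, ?_⟩, ?_, ?_⟩
  · intro s hs
    rw [hfix s, hγ.2.1 s hs]
    rw [hγ.2.1 s hs]; exact hD s hs
  · intro s
    exact (hΨge γ' s).trans (hlt.le.trans (hΨle γ b hγ.2.2))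
  · intro heq
    have : γ' = γ := congrArg Subtype.val heq
    rw [this] at hlt
    exact lt_irrefl _ hlt
  · set t := h / (1 + ‖γ‖) with ht
    have ht0 : 0 < t := by positivity
    have ht1 : t ≤ 1 := by
      rw [ht, div_le_one hn]
      have := norm_nonneg γ
      linarith
    have hht : (1 + ‖γ‖) * t = h := by rw [ht]; field_simp
    have hnorm : 1 + ‖γ'‖ ≤ (1 + ‖γ‖) * (1 + t) := by
      have h1 : ‖γ'‖ ≤ ‖γ‖ + ‖γ' - γ‖ := by
        have := norm_add_le γ (γ' - γ)
        simpa using this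
      rw [dist_comm, dist_eq_norm] at hdist
      rw [mul_add, hht]
      linarith
    have hexp : Real.exp (2 * Ψ γ' / α) ≤ Real.exp (2 * Ψ γ / α) * Real.exp (-2 * t) := by
      rw [← Real.exp_add, Real.exp_le_exp]
      have h1 : 2 * Ψ γ' / α ≤ 2 * (Ψ γ - α * t) / α := by gcongr
      refine h1.trans (le_of_eq ?_)
      field_simp
      ring
    have hE1 : 1 ≤ Real.exp (2 * Ψ γ / α) := by
      apply Real.one_le_exp
      have : 0 ≤ Ψ γ := by linarith
      positivity
    have hfac : (1 + t) * Real.exp (-2 * t) ≤ 1 - t / 2 := by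
      have h1 : 1 + t ≤ Real.exp t := by
        have := Real.add_one_le_exp t
        linarith
      have h2 : Real.exp (-2 * t) = (Real.exp t)⁻¹ * (Real.exp t)⁻¹ := by
        rw [← Real.exp_neg, ← Real.exp_add]; congr 1; ring
      have h3 : 0 < Real.exp t := Real.exp_pos t
      have h4 : (Real.exp t)⁻¹ ≤ (1 + t)⁻¹ := by
        gcongr
      have h5 : (1 + t)⁻¹ ≤ 1 - t / 2 := by
        rw [inv_le_iff_one_le_mul₀ (by positivity)]
        nlinarith
      calc (1 + t) * Real.exp (-2 * t) ≤ Real.exp t * Real.exp (-2 * t) := by gcongr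
        _ = (Real.exp t)⁻¹ := by rw [h2]; field_simp
        _ ≤ _ := h4.trans h5
    have hd2 : dist (⟨γ, hγ⟩ : G) ⟨γ', hodd, by
        intro s hs
        rw [hfix s, hγ.2.1 s hs]
        rw [hγ.2.1 s hs]; exact hD s hs, by
        intro s
        exact (hΨge γ' s).trans (hlt.le.trans (hΨle γ b hγ.2.2))⟩ ≤ h := hdist
    have hmain : (1 + ‖γ'‖) * Real.exp (2 * Ψ γ' / α)
        ≤ (1 + ‖γ‖) * Real.exp (2 * Ψ γ / α) * (1 - t / 2) := by
      calc (1 + ‖γ'‖) * Real.exp (2 * Ψ γ' / α)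
          ≤ ((1 + ‖γ‖) * (1 + t)) * (Real.exp (2 * Ψ γ / α) * Real.exp (-2 * t)) := by gcongr
        _ = (1 + ‖γ‖) * Real.exp (2 * Ψ γ / α) * ((1 + t) * Real.exp (-2 * t)) := by ring
        _ ≤ _ := by gcongr
    have hfin : h / 2 ≤ (1 + ‖γ‖) * Real.exp (2 * Ψ γ / α) * (t / 2) := by
      have : (1 + ‖γ‖) * Real.exp (2 * Ψ γ / α) * (t / 2) = Real.exp (2 * Ψ γ / α) * (h / 2) := by
        rw [← hht]; ring
      rw [this]
      exact le_mul_of_one_le_left (by positivity) hE1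
    show (1 + ‖γ'‖) * Real.exp (2 * Ψ γ' / α) + _ ≤ (1 + ‖γ‖) * Real.exp (2 * Ψ γ / α)
    linarith

lemma cerami_bound {X : Type*} [NormedAddCommGroup X] [NormedSpace ℝ X]
    (J : X → ℝ) (dJ : X → X →L[ℝ] ℝ)
    (hdJ : ∀ u, HasFDerivAt J (dJ u) u) (hdJc : Continuous dJ)
    (hCerami₁ : ∀ c : ℝ, ∀ u : ℕ → X, Bornology.IsBounded (Set.range u) →
      Tendsto (fun n => J (u n)) atTop (𝓝 c) →
      Tendsto (fun n => ‖dJ (u n)‖) atTop (𝓝 0) →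
      ∃ (φ : ℕ → ℕ) (v : X), StrictMono φ ∧ Tendsto (fun n => u (φ n)) atTop (𝓝 v))
    (hCerami₂ : ∀ c : ℝ, ∃ δ r β : ℝ, 0 < δ ∧ 0 < r ∧ 0 < β ∧
      ∀ u : X, c - δ ≤ J u → J u ≤ c + δ → r ≤ ‖u‖ → β ≤ ‖dJ u‖ * ‖u‖)
    (M : ℝ) (hM : ∀ u, M ≤ J u → dJ u ≠ 0) (b : ℝ) :
    ∃ β : ℝ, 0 < β ∧ ∀ u, M ≤ J u → J u ≤ b → β ≤ ‖dJ u‖ * (1 + ‖u‖) := by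
  by_contra hcon
  push Not at hcon
  have hJc : Continuous J := continuous_iff_continuousAt.2 fun u => (hdJ u).continuousAt
  choose u hu1 hu2 hu3 using fun n : ℕ => hcon (1 / ((n : ℝ) + 1)) (by positivity)
  obtain ⟨c, hc, φ, hφ, hlim⟩ := (isCompact_Icc (a := M) (b := b)).tendsto_subseq
    (x := fun n => J (u n)) (fun n => ⟨hu1 n, hu2 n⟩)
  obtain ⟨δ, r, β, hδ, hr, hβ, hC⟩ := hCerami₂ c
  have h0 : Tendsto (fun n => 1 / (((φ n : ℕ) : ℝ) + 1)) atTop (𝓝 0) :=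
    (tendsto_one_div_add_atTop_nhds_zero_nat (𝕜 := ℝ)).comp hφ.tendsto_atTop
  have hev : ∀ᶠ n in atTop, ‖u (φ n)‖ < r := by
    have e1 : ∀ᶠ n in atTop, J (u (φ n)) ∈ Set.Ioo (c - δ) (c + δ) :=
      hlim (Ioo_mem_nhds (by linarith) (by linarith))
    have e2 : ∀ᶠ n in atTop, 1 / (((φ n : ℕ) : ℝ) + 1) < β := h0.eventually_lt_const hβ
    filter_upwards [e1, e2] with n h1 h2
    by_contra h3
    push Not at h3
    have h4 := hC _ h1.1.le h1.2.le h3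
    have h5 := hu3 (φ n)
    have h6 := norm_nonneg (dJ (u (φ n)))
    nlinarith
  obtain ⟨N, hN⟩ := eventually_atTop.1 hev
  have hsh : Tendsto (fun n : ℕ => n + N) atTop atTop := tendsto_add_atTop_nat N
  have hd0 : Tendsto (fun n => ‖dJ (u (φ (n + N)))‖) atTop (𝓝 0) := by
    refine squeeze_zero (fun n => norm_nonneg _) (fun n => ?_) (h0.comp hsh)
    have h5 := hu3 (φ (n + N))
    have h6 := norm_nonneg (dJ (u (φ (n + N))))
    have h7 := norm_nonneg (u (φ (n + N)))
    simp only [Function.comp]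
    nlinarith
  obtain ⟨ψ, v, hψ, hv⟩ := hCerami₁ c (fun n => u (φ (n + N)))
    ((Metric.isBounded_ball (x := (0 : X)) (r := r)).subset (by
      rintro _ ⟨n, rfl⟩
      simpa using hN (n + N) (by omega)))
    (hlim.comp hsh) hd0
  have hJv : J v = c := tendsto_nhds_unique ((hJc.tendsto v).comp hv)
    ((hlim.comp hsh).comp hψ.tendsto_atTop)
  have hdv : ‖dJ v‖ = 0 := tendsto_nhds_unique ((hdJc.norm.tendsto v).comp hv)
    (hd0.comp hψ.tendsto_atTop)
  exact hM v (hJv ▸ hc.1) (norm_eq_zero.1 hdv)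

lemma linking {X : Type*} [NormedAddCommGroup X] [NormedSpace ℝ X]
    (Y Z : Submodule ℝ X) [FiniteDimensional ℝ Y] (hZ : IsClosed (Z : Set X))
    (hYZ : Y ⊔ Z = ⊤) (w : X) (hwY : w ∈ Y) (hwZ : w ∈ Z) (hw : w ≠ 0)
    (ρ r : ℝ) (hr : 0 < r) (hρ : r < ρ)
    (γ : C(Metric.closedBall (0 : Y) ρ, X)) (hodd : ∀ s, γ (-s) = - γ s)
    (hid : ∀ s : Metric.closedBall (0 : Y) ρ, ‖(s : Y)‖ = ρ → γ s = ((s : Y) : X)) :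
    ∃ s, γ s ∈ Z ∧ ‖γ s‖ = r := by
  haveI : IsClosed (Z : Set X) := hZ
  have hρ0 : 0 < ρ := hr.trans hρ
  -- the quotient map restricted to Y
  let q : Y →ₗ[ℝ] X ⧸ Z := Z.mkQ ∘ₗ Y.subtype
  have hq : Function.Surjective q := by
    intro x
    obtain ⟨x, rfl⟩ := Z.mkQ_surjective x
    have : x ∈ Y ⊔ Z := hYZ ▸ Submodule.mem_top
    obtain ⟨y, hy, z, hz, rfl⟩ := Submodule.mem_sup.1 this
    refine ⟨⟨y, hy⟩, ?_⟩
    have hz0 : Z.mkQ z = 0 := (Submodule.Quotient.mk_eq_zero Z).2 hz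
    rw [map_add, hz0, add_zero]
    rfl
  haveI : FiniteDimensional ℝ (X ⧸ Z) := Module.Finite.of_surjective q hq
  have hlt : Module.finrank ℝ (X ⧸ Z) < Module.finrank ℝ Y := by
    have h1 := q.finrank_range_add_finrank_ker
    rw [LinearMap.range_eq_top.2 hq, finrank_top] at h1
    have h2 : 0 < Module.finrank ℝ (LinearMap.ker q) := by
      haveI : Nontrivial (LinearMap.ker q) := by
        refine ⟨⟨⟨⟨w, hwY⟩, ?_⟩, 0, ?_⟩⟩
        · simp [q, hwZ]
        · intro h
          apply hw
          simpa using congrArg (fun t : LinearMap.ker q => ((t : Y) : X)) h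
      exact Module.finrank_pos
    omega
  let T : (X ⧸ Z) ≃L[ℝ] (Fin (Module.finrank ℝ (X ⧸ Z)) → ℝ) :=
    ContinuousLinearEquiv.ofFinrankEq (by simp)
  let S : (Fin (Module.finrank ℝ Y) → ℝ) ≃L[ℝ] Y :=
    ContinuousLinearEquiv.ofFinrankEq (by simp)
  have hmaxpos : ∀ y : Y, 0 < max ρ ‖y‖ := fun y => lt_max_of_lt_left hρ0
  let P : Y → Metric.closedBall (0 : Y) ρ := fun y => ⟨(ρ / max ρ ‖y‖) • y, by
    rw [mem_closedBall_zero_iff, norm_smul, Real.norm_eq_abs, abs_of_pos (by have := hmaxpos y; positivity),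
      div_mul_eq_mul_div, div_le_iff₀ (hmaxpos y)]
    exact mul_le_mul_of_nonneg_left (le_max_right _ _) hρ0.le⟩
  have hPv : ∀ y, (P y : Y) = (ρ / max ρ ‖y‖) • y := fun y => rfl
  have hPc : Continuous P := by
    refine Continuous.subtype_mk ?_ _
    have h1 : Continuous fun y : Y => ρ / max ρ ‖y‖ :=
      continuous_const.div (continuous_const.max continuous_norm) fun y => (hmaxpos y).ne'
    exact h1.smul continuous_id
  have hPodd : ∀ y, P (-y) = - P y := by
    intro y
    apply Subtype.ext
    rw [hPv, norm_neg, smul_neg]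
    rfl
  have hPin : ∀ y, ‖y‖ ≤ ρ → (P y : Y) = y := by
    intro y hy
    rw [hPv, max_eq_left hy, div_self hρ0.ne', one_smul]
  have hPout : ∀ y, ρ ≤ ‖y‖ → ‖(P y : Y)‖ = ρ := by
    intro y hy
    have : 0 < ‖y‖ := hρ0.trans_le hy
    rw [hPv, max_eq_right hy, norm_smul, Real.norm_eq_abs, abs_of_pos (by positivity)]
    field_simp
  let G : Y → X := fun y => γ (P y) + ((y : X) - ((P y : Y) : X))
  have hGc : Continuous G := by
    have h1 : Continuous fun y => γ (P y) := γ.continuous.comp hPc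
    have h2 : Continuous fun y => ((P y : Y) : X) :=
      continuous_subtype_val.comp (continuous_subtype_val.comp hPc)
    exact h1.add (continuous_subtype_val.sub h2)
  have hGodd : ∀ y, G (-y) = - G y := by
    intro y
    have h1 : ((-(P y) : Metric.closedBall (0 : Y) ρ) : Y) = - (P y : Y) := rfl
    simp only [G, hPodd, hodd, h1, Submodule.coe_neg]
    abel
  have hGout : ∀ y, ρ ≤ ‖y‖ → G y = (y : X) := by
    intro y hy
    simp only [G]
    rw [hid _ (hPout y hy)]
    abel
  have hGin : ∀ y, ‖y‖ ≤ ρ → G y = γ (P y) := by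
    intro y hy
    simp only [G]
    rw [hPin y hy]
    simp
  have hG0 : G 0 = 0 := by
    have h := hGodd 0
    rw [neg_zero] at h
    have h2 : (2 : ℝ) • G 0 = 0 := by rw [two_smul]; nth_rewrite 1 [h]; simp
    simpa using h2
  obtain ⟨C, hC0, hC⟩ := S.symm.toContinuousLinearMap.bound
  obtain ⟨x, hx1, hx2⟩ := topo hlt (fun x => T (Z.mkQ (G (S x))))
    (T.continuous.comp (continuous_quot_mk.comp (hGc.comp S.continuous)))
    (fun x => by simp only [map_neg, hGodd])
    (fun x => ‖G (S x)‖ - r) ((hGc.comp S.continuous).norm.sub continuous_const)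
    (fun x => by simp only [map_neg, hGodd, norm_neg])
    (by simp only [map_zero, hG0, norm_zero]; linarith) (C * ρ) (by positivity)
    (fun x hx => by
      have h1 : ρ ≤ ‖S x‖ := by
        have h2 := hC (S x)
        simp only [ContinuousLinearEquiv.coe_coe, ContinuousLinearEquiv.symm_apply_apply] at h2
        exact le_of_mul_le_mul_left (hx.trans h2) hC0
      rw [hGout _ h1, ← Submodule.coe_norm]
      linarith)
  have hxZ : G (S x) ∈ Z := by
    have h1 : Z.mkQ (G (S x)) = 0 := T.injective (by rw [map_zero]; exact hx1)
    simpa using h1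
  have hxr : ‖G (S x)‖ = r := by linarith
  have hle : ‖S x‖ ≤ ρ := by
    by_contra h
    push Not at h
    have h1 := hxr
    rw [hGout _ h.le, ← Submodule.coe_norm] at h1
    linarith
  refine ⟨P (S x), ?_, ?_⟩
  · rw [← hGin _ hle]; exact hxZ
  · rw [← hGin _ hle]; exact hxr

lemma main {X : Type*} [NormedAddCommGroup X] [NormedSpace ℝ X] [CompleteSpace X]
    (e : ℕ → X)
    (hspan : (Submodule.span ℝ (Set.range fun j : ℕ => e (j + 1))).topologicalClosure = ⊤)
    (Y : ℕ → Submodule ℝ X) (Z : ℕ → Submodule ℝ X)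
    (hY : ∀ k, Y k = Submodule.span ℝ (e '' Set.Icc 1 k))
    (hZ : ∀ k, Z k = (Submodule.span ℝ (e '' Set.Ici k)).topologicalClosure)
    (J : X → ℝ) (dJ : X → X →L[ℝ] ℝ)
    (hdJ : ∀ u, HasFDerivAt J (dJ u) u) (hdJc : Continuous dJ)
    (heven : ∀ u, J (-u) = J u)
    (hCerami₁ : ∀ c : ℝ, ∀ u : ℕ → X, Bornology.IsBounded (Set.range u) →
      Tendsto (fun n => J (u n)) atTop (𝓝 c) →
      Tendsto (fun n => ‖dJ (u n)‖) atTop (𝓝 0) →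
      ∃ (φ : ℕ → ℕ) (v : X), StrictMono φ ∧ Tendsto (fun n => u (φ n)) atTop (𝓝 v))
    (hCerami₂ : ∀ c : ℝ, ∃ δ r β : ℝ, 0 < δ ∧ 0 < r ∧ 0 < β ∧
      ∀ u : X, c - δ ≤ J u → J u ≤ c + δ → r ≤ ‖u‖ → β ≤ ‖dJ u‖ * ‖u‖)
    (ρ r : ℕ → ℝ) (hr : ∀ k, 0 < r k) (hρr : ∀ k, r k < ρ k)
    (hA₁ : Tendsto (fun k => sInf {x : ℝ | ∃ u ∈ Z k, ‖u‖ = r k ∧ J u = x})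
      atTop atTop)
    (hA₂ : ∀ k, sSup {x : ℝ | ∃ u ∈ Y k, ‖u‖ = ρ k ∧ J u = x} ≤ 0)
    (M : ℝ) (hM0 : 0 ≤ M) (hM : ∀ u, M ≤ J u → dJ u ≠ 0) : False := by
  have hJc : Continuous J := continuous_iff_continuousAt.2 fun u => (hdJ u).continuousAt
  obtain ⟨K, hK⟩ := eventually_atTop.1 (hA₁.eventually_gt_atTop M)
  -- a nonzero basis vector with large index
  obtain ⟨k, hkK, hk1, hek⟩ : ∃ k, K ≤ k ∧ 1 ≤ k ∧ e k ≠ 0 := by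
    by_contra hcon
    push Not at hcon
    have h1 := hK (max K 1) (le_max_left _ _)
    have hZ0 : Z (max K 1) = ⊥ := by
      rw [hZ]
      have : Submodule.span ℝ (e '' Set.Ici (max K 1)) = ⊥ := by
        rw [Submodule.span_eq_bot]
        rintro _ ⟨j, hj, rfl⟩
        exact hcon j ((le_max_left _ _).trans hj) ((le_max_right _ _).trans hj)
      rw [this]
      exact (Submodule.closed_of_finiteDimensional (⊥ : Submodule ℝ X)).submodule_topologicalClosure_eq
    have hemp : {x : ℝ | ∃ u ∈ Z (max K 1), ‖u‖ = r (max K 1) ∧ J u = x} = ∅ := by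
      apply Set.eq_empty_of_forall_notMem
      rintro x ⟨u, hu, hu2, -⟩
      rw [hZ0, Submodule.mem_bot] at hu
      have := hr (max K 1)
      rw [hu, norm_zero] at hu2
      linarith
    rw [hemp, Real.sInf_empty] at h1
    linarith
  have hak := hK k hkK
  have hZlow : ∀ u ∈ Z k, ‖u‖ = r k → M < J u := by
    intro u hu hur
    have hbdd : BddBelow {x : ℝ | ∃ u ∈ Z k, ‖u‖ = r k ∧ J u = x} := by
      by_contra h
      rw [Real.sInf_of_not_bddBelow h] at hak
      linarith
    exact hak.trans_le (csInf_le hbdd ⟨u, hu, hur, rfl⟩)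
  haveI : FiniteDimensional ℝ (Y k) := by
    rw [hY]
    exact FiniteDimensional.span_of_finite ℝ ((Set.finite_Icc 1 k).image e)
  have hZc : IsClosed (Z k : Set X) := by
    rw [hZ]; exact Submodule.isClosed_topologicalClosure _
  have hYZ : Y k ⊔ Z k = ⊤ := by
    have hcl : IsClosed ((Y k ⊔ Z k : Submodule ℝ X) : Set X) := by
      rw [sup_comm]
      exact Submodule.isClosed_sup_finiteDimensional _ _ hZc
    rw [eq_top_iff, ← hspan]
    refine Submodule.topologicalClosure_minimal _ ?_ hcl
    rw [Submodule.span_le]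
    rintro _ ⟨j, rfl⟩
    by_cases hj : j + 1 ≤ k
    · refine Submodule.mem_sup_left ?_
      rw [hY]
      exact Submodule.subset_span ⟨j + 1, ⟨by omega, hj⟩, rfl⟩
    · refine Submodule.mem_sup_right ?_
      rw [hZ]
      refine Submodule.le_topologicalClosure _ (Submodule.subset_span ⟨j + 1, ?_, rfl⟩)
      simp only [Set.mem_Ici]; omega
  have hkY : e k ∈ Y k := by
    rw [hY]; exact Submodule.subset_span ⟨k, ⟨hk1, le_rfl⟩, rfl⟩
  have hkZ : e k ∈ Z k := by
    rw [hZ]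
    exact Submodule.le_topologicalClosure _ (Submodule.subset_span ⟨k, Set.mem_Ici.2 le_rfl, rfl⟩)
  have hρ0 : 0 < ρ k := (hr k).trans (hρr k)
  haveI : ProperSpace (Y k) := FiniteDimensional.proper ℝ (Y k)
  haveI : CompactSpace (Metric.closedBall (0 : Y k) (ρ k)) :=
    isCompact_iff_compactSpace.1 (isCompact_closedBall _ _)
  haveI : Nonempty (Metric.closedBall (0 : Y k) (ρ k)) :=
    ⟨⟨0, Metric.mem_closedBall_self hρ0.le⟩⟩
  let γ₀ : C(Metric.closedBall (0 : Y k) (ρ k), X) :=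
    ⟨fun s => ((s : Y k) : X), continuous_subtype_val.comp continuous_subtype_val⟩
  obtain ⟨s₀, hs₀⟩ : ∃ s₀, ∀ s, J (γ₀ s) ≤ J (γ₀ s₀) := by
    obtain ⟨s₀, -, h⟩ := isCompact_univ.exists_isMaxOn Set.univ_nonempty
      (hJc.comp γ₀.continuous).continuousOn
    exact ⟨s₀, fun s => h (Set.mem_univ s)⟩
  obtain ⟨β, hβ, hlow⟩ := cerami_bound J dJ hdJ hdJc hCerami₁ hCerami₂ M hM (J (γ₀ s₀))
  refine minimax J dJ hdJ hdJc heven (B := Metric.closedBall (0 : Y k) (ρ k))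
    (fun s => -s) continuous_neg neg_neg {s | ‖(s : Y k)‖ = ρ k} γ₀ (fun s => rfl)
    M (J (γ₀ s₀)) β hM0 hβ ?_ hs₀ hlow ?_
  · intro s hs
    have hbdd : BddAbove {x : ℝ | ∃ u ∈ Y k, ‖u‖ = ρ k ∧ J u = x} := by
      refine ⟨J (γ₀ s₀), ?_⟩
      rintro _ ⟨u, hu, hu2, rfl⟩
      exact hs₀ ⟨⟨u, hu⟩, by rw [mem_closedBall_zero_iff]; exact hu2.le⟩
    exact ((le_csSup hbdd ⟨_, (s : Y k).2, hs, rfl⟩).trans (hA₂ k)).trans hM0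
  · intro γ hγ hγD
    obtain ⟨s, hs1, hs2⟩ := linking (Y k) (Z k) hZc hYZ (e k) hkY hkZ hek (ρ k) (r k)
      (hr k) (hρr k) γ hγ (fun s hs => hγD s hs)
    exact ⟨s, hZlow _ hs1 hs2⟩

end Fountain

/-- **Fountain theorem under the Cerami condition** (Theorem 4.1 of the paper).

`X` is a real Banach space, `e 1, e 2, …` a sequence whose closed linear span is
all of `X`, `Y k = span {e 1, …, e k}`, `Z k` the closed span of `{e j : j ≥ k}`.
`J : X → ℝ` is `C¹` (with derivative `dJ`), even, and satisfies the Cerami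
condition at every level `c`. If there exist `ρ k > r k > 0` with
(A₁) `a k := inf {J u : u ∈ Z k, ‖u‖ = r k} → ∞` and
(A₂) `b k := sup {J u : u ∈ Y k, ‖u‖ = ρ k} ≤ 0`,
then `J` has an unbounded sequence of critical values. -/
theorem fountain_theorem_cerami
    {X : Type*} [NormedAddCommGroup X] [NormedSpace ℝ X] [CompleteSpace X]
    (e : ℕ → X)
    (hspan : (Submodule.span ℝ (Set.range fun j : ℕ => e (j + 1))).topologicalClosure = ⊤)
    (Y : ℕ → Submodule ℝ X) (Z : ℕ → Submodule ℝ X)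
    (hY : ∀ k, Y k = Submodule.span ℝ (e '' Set.Icc 1 k))
    (hZ : ∀ k, Z k = (Submodule.span ℝ (e '' Set.Ici k)).topologicalClosure)
    (J : X → ℝ) (dJ : X → X →L[ℝ] ℝ)
    (hdJ : ∀ u, HasFDerivAt J (dJ u) u) (hdJc : Continuous dJ)
    (heven : ∀ u, J (-u) = J u)
    -- Cerami condition (i): bounded almost-critical sequences at level c have a
    -- convergent subsequence
    (hCerami₁ : ∀ c : ℝ, ∀ u : ℕ → X, Bornology.IsBounded (Set.range u) →
      Tendsto (fun n => J (u n)) atTop (𝓝 c) →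
      Tendsto (fun n => ‖dJ (u n)‖) atTop (𝓝 0) →
      ∃ (φ : ℕ → ℕ) (v : X), StrictMono φ ∧ Tendsto (fun n => u (φ n)) atTop (𝓝 v))
    -- Cerami condition (ii)
    (hCerami₂ : ∀ c : ℝ, ∃ δ r β : ℝ, 0 < δ ∧ 0 < r ∧ 0 < β ∧
      ∀ u : X, c - δ ≤ J u → J u ≤ c + δ → r ≤ ‖u‖ → β ≤ ‖dJ u‖ * ‖u‖)
    (ρ r : ℕ → ℝ) (hr : ∀ k, 0 < r k) (hρr : ∀ k, r k < ρ k)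
    -- (A₁): a k → ∞
    (hA₁ : Tendsto (fun k => sInf {x : ℝ | ∃ u ∈ Z k, ‖u‖ = r k ∧ J u = x})
      atTop atTop)
    -- (A₂): b k ≤ 0
    (hA₂ : ∀ k, sSup {x : ℝ | ∃ u ∈ Y k, ‖u‖ = ρ k ∧ J u = x} ≤ 0) :
    ∃ u : ℕ → X, (∀ n, dJ (u n) = 0) ∧ Tendsto (fun n => J (u n)) atTop atTop := by
  by_cases h : ∃ M : ℝ, 0 ≤ M ∧ ∀ u, M ≤ J u → dJ u ≠ 0
  · obtain ⟨M, hM0, hM⟩ := h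
    exact (Fountain.main e hspan Y Z hY hZ J dJ hdJ hdJc heven hCerami₁ hCerami₂ ρ r hr hρr
      hA₁ hA₂ M hM0 hM).elim
  · push Not at h
    choose u hu1 hu2 using fun n : ℕ => h n (Nat.cast_nonneg n)
    exact ⟨u, hu2, tendsto_atTop_mono hu1 tendsto_natCast_atTop_atTop⟩
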